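/- arXiv:2009.14317 — 5 statements merged into one kernel-verified Lean document; each statement's English description precedes it below -/
import Mathlib

section
/- Let X be a compact metric space with a countable basis of open sets. In the hyperspace 𝒦(C⁰(X)) of nonempty compact subsets of C⁰(X) equipped with the Hausdorff metric, the set of transitive IFS — i.e. the set of K ∈ 𝒦(C⁰(X)) such that for every pair of nonempty open sets U, V ⊆ X there exist n ≥ 1 and g₁,…,gₙ ∈ K with (gₙ ∘ ⋯ ∘ g₁)(U) ∩ V ≠ ∅ — is a Gδ subset of 𝒦(C⁰(X)). -/
open TopologicalSpace

/-- The composition `g_{n} ∘ ⋯ ∘ g_1` (with `g_i = g (i-1)` in 0-based indexing) of a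
sequence of continuous self-maps; `compSeq g 0 = id`. -/
def compSeq {X : Type*} [TopologicalSpace X] (g : ℕ → C(X, X)) : ℕ → X → X
  | 0 => id
  | k + 1 => g k ∘ compSeq g k

theorem continuous_compSeq_apply {X : Type*} [TopologicalSpace X] [LocallyCompactSpace X]
    (n : ℕ) (x : X) : Continuous fun g : ℕ → C(X, X) => compSeq g n x := by
  induction n with
  | zero => exact continuous_const
  | succ k ih => exact (continuous_apply k).eval ih

/-- A finite selection condition that is open in the sequence is open in the compact set from
which the first `n` terms are selected. -/
theorem isOpen_setOf_exists_seq_mem {α : Type*} [TopologicalSpace α] (n : ℕ)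
    {S : Set (ℕ → α)} (hS : IsOpen S) :
    IsOpen {K : NonemptyCompacts α | ∃ g ∈ S, ∀ i < n, g i ∈ (K : Set α)} := by
  classical
  rw [isOpen_iff_mem_nhds]
  rintro K ⟨g, hgS, hgK⟩
  obtain ⟨I, u, hu, hIS⟩ := isOpen_pi_iff.mp hS g hgS
  have hnhds : ∀ i ∈ Finset.range n, ∀ᶠ L : NonemptyCompacts α in nhds K,
      ∃ a ∈ (L : Set α), i ∈ I → a ∈ u i := by
    intro i hi
    have hgi := hgK i (Finset.mem_range.mp hi)
    by_cases hiI : i ∈ I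
    · filter_upwards [(NonemptyCompacts.isOpen_inter_nonempty_of_isOpen (hu i hiI).1).mem_nhds
        ⟨g i, hgi, (hu i hiI).2⟩]
      rintro L ⟨a, haL, hau⟩
      exact ⟨a, haL, fun _ => hau⟩
    · exact .of_forall fun L => ⟨_, L.nonempty.some_mem, fun h => absurd h hiI⟩
  filter_upwards [(Filter.eventually_all_finset _).mpr hnhds] with L hL
  have : Nonempty α := ⟨K.nonempty.some⟩
  choose! a haL hau using hL
  refine ⟨fun i => if i < n then a i else g i, hIS fun i hi => ?_, fun i hi => ?_⟩
  · by_cases hin : i < n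
    · simpa [hin] using hau i (Finset.mem_range.mpr hin) hi
    · simpa [hin] using (hu i hi).2
  · simpa [hi] using haL i (Finset.mem_range.mpr hi)

theorem isOpen_setOf_exists_compSeq_mem {X : Type*} [TopologicalSpace X] [LocallyCompactSpace X]
    (U : Set X) {V : Set X} (hV : IsOpen V) :
    IsOpen {K : NonemptyCompacts C(X, X) |
      ∃ n ≥ 1, ∃ g : ℕ → C(X, X), (∀ i < n, g i ∈ (K : Set C(X, X))) ∧
        ∃ x ∈ U, compSeq g n x ∈ V} := by
  have hS (n : ℕ) : IsOpen {g : ℕ → C(X, X) | ∃ x ∈ U, compSeq g n x ∈ V} := by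
    have heq : {g : ℕ → C(X, X) | ∃ x ∈ U, compSeq g n x ∈ V} =
        ⋃ x ∈ U, (fun g => compSeq g n x) ⁻¹' V := by
      ext g
      simp
    rw [heq]
    exact isOpen_biUnion fun x _ => hV.preimage (continuous_compSeq_apply n x)
  convert isOpen_biUnion (s := {n : ℕ | n ≥ 1}) fun n _ => isOpen_setOf_exists_seq_mem n (hS n)
    using 1
  ext K
  simp [and_comm]

/-- Let `X` be a compact metric space with a countable basis. In the
hyperspace `𝒦(C(X, X))` of nonempty compact subsets of `C(X, X)` with the Hausdorff metric,
the set of transitive IFS — those `K` such that for all nonempty open `U, V ⊆ X` there are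
`n ≥ 1` and `g₁, …, gₙ ∈ K` with `(gₙ ∘ ⋯ ∘ g₁)(U) ∩ V ≠ ∅` — is a Gδ set. -/
theorem transitive_ifs_isGδ {X : Type*} [MetricSpace X] [CompactSpace X]
    [SecondCountableTopology X] :
    IsGδ {K : NonemptyCompacts C(X, X) |
      ∀ U V : Set X, IsOpen U → IsOpen V → U.Nonempty → V.Nonempty →
        ∃ n ≥ 1, ∃ g : ℕ → C(X, X), (∀ i < n, g i ∈ (K : Set C(X, X))) ∧
          ∃ x ∈ U, compSeq g n x ∈ V} := by
  let B := countableBasis X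
  have hB : IsTopologicalBasis B := isBasis_countableBasis X
  have hBc : B.Countable := countable_countableBasis X
  have hG : IsGδ (⋂ U ∈ B, ⋂ V ∈ B, {K : NonemptyCompacts C(X, X) |
      ∃ n ≥ 1, ∃ g : ℕ → C(X, X), (∀ i < n, g i ∈ (K : Set C(X, X))) ∧
        ∃ x ∈ U, compSeq g n x ∈ V}) :=
    .biInter hBc fun U _ => .biInter hBc fun V hV =>
      (isOpen_setOf_exists_compSeq_mem U (hB.isOpen hV)).isGδ
  convert hG using 1
  ext K
  simp only [Set.mem_iInter]
  constructor
  · intro h U hU V hV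
    exact h U V (hB.isOpen hU) (hB.isOpen hV) (nonempty_of_mem_countableBasis hU)
      (nonempty_of_mem_countableBasis hV)
  · rintro h U V hU hV ⟨x, hx⟩ ⟨y, hy⟩
    obtain ⟨U', hU', -, hUU⟩ := hB.exists_subset_of_mem_open hx hU
    obtain ⟨V', hV', -, hVV⟩ := hB.exists_subset_of_mem_open hy hV
    obtain ⟨n, hn, g, hg, z, hz, hzV⟩ := h U' hU' V' hV'
    exact ⟨n, hn, g, hg, z, hUU hz, hVV hzV⟩
end

section
/- (Glavan–Gutu) Every hyperbolic IFS has the concordant shadowing property: if ω : Λ × X → X is an IFS with sup_{λ∈Λ} sup_{x≠y} d(ω_λ(x),ω_λ(y))/d(x,y) < 1, then for every ε > 0 there exists δ > 0 such that every δ-chain (x_k) with parameter sequence σ = (λ₁,λ₂,…) admits a point y ∈ X with d(x_k, ω_{σ_k}(y)) < ε for all k ≥ 0. -/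
/-- The iterate `ω_{σ_k} = ω_{λ_k} ∘ ⋯ ∘ ω_{λ_1}` of an IFS along the parameter sequence
`σ` (0-based: `σ k` is the parameter `λ_{k+1}`); `iterIFS ω σ 0 = id`. -/
def iterIFS {Λ X : Type*} (ω : Λ × X → X) (σ : ℕ → Λ) : ℕ → X → X
  | 0 => id
  | k + 1 => fun y => ω (σ k, iterIFS ω σ k y)

/-- **Glavan–Gutu.** Every hyperbolic IFS (all partial maps contract with a
uniform constant `c < 1`) has the concordant shadowing property: for every `ε > 0` there is
`δ > 0` such that every `δ`-chain `(x_k)` with parameter sequence `σ` admits `y ∈ X` with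
`d(x_k, ω_{σ_k}(y)) < ε` for all `k ≥ 0`. -/
theorem hyperbolic_ifs_concordant_shadowing {Λ X : Type*}
    [MetricSpace Λ] [CompactSpace Λ] [MetricSpace X] [CompactSpace X]
    (ω : Λ × X → X) (hω : Continuous ω)
    (hyp : ∃ c < (1 : ℝ), ∀ (l : Λ) (x y : X), dist (ω (l, x)) (ω (l, y)) ≤ c * dist x y) :
    ∀ ε > 0, ∃ δ > 0, ∀ (σ : ℕ → Λ) (x : ℕ → X),
      (∀ k, dist (x (k + 1)) (ω (σ k, x k)) ≤ δ) →
      ∃ y : X, ∀ k, dist (x k) (iterIFS ω σ k y) < ε := by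
  obtain ⟨c, hc, hyp⟩ := hyp
  have hm : max c 0 < 1 := max_lt hc one_pos
  intro ε hε
  refine ⟨(1 - max c 0) * (ε / 2), mul_pos (sub_pos.2 hm) (half_pos hε), fun σ x hx => ⟨x 0, ?_⟩⟩
  suffices h : ∀ k, dist (x k) (iterIFS ω σ k (x 0)) ≤ ε / 2 from
    fun k => (h k).trans_lt (half_lt_self hε)
  intro k
  induction k with
  | zero => simpa [iterIFS] using (half_pos hε).le
  | succ k ih =>
    calc dist (x (k + 1)) (ω (σ k, iterIFS ω σ k (x 0)))
        ≤ dist (x (k + 1)) (ω (σ k, x k))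
          + dist (ω (σ k, x k)) (ω (σ k, iterIFS ω σ k (x 0))) := dist_triangle _ _ _
      _ ≤ (1 - max c 0) * (ε / 2) + max c 0 * (ε / 2) := by
        refine add_le_add (hx k) ((hyp _ _ _).trans ?_)
        exact mul_le_mul (le_max_left c 0) ih dist_nonneg (le_max_right c 0)
      _ = ε / 2 := by ring
end

section
/- Let ω : Λ × X → X be an IFS with Λ and X compact metric spaces. If ω has the finite shadowing property, then ω has the shadowing property: for every ε > 0 there exists δ > 0 such that every (infinite) δ-chain (x_k)_{k≥0} admits a point y ∈ X and a parameter sequence σ ∈ Λ^ℕ with d(x_k, ω_{σ_k}(y)) < ε for all k ≥ 0. -/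
/-- The iterates of a continuous IFS depend continuously on the initial point and on the parameter
sequence jointly. -/
theorem continuous_iterIFS {Λ X : Type*} [TopologicalSpace Λ] [TopologicalSpace X]
    {ω : Λ × X → X} (hω : Continuous ω) (k : ℕ) :
    Continuous fun p : X × (ℕ → Λ) => iterIFS ω p.2 k p.1 := by
  induction k with
  | zero => exact continuous_fst
  | succ k ih => exact hω.comp (((continuous_apply k).comp continuous_snd).prodMk ih)

/-- If an IFS `ω : Λ × X → X` (with `Λ`, `X` compact metric spaces) has the
finite shadowing property, then it has the shadowing property: for every `ε > 0` there is
`δ > 0` such that every infinite `δ`-chain `(x_k)` admits `y ∈ X` and `σ ∈ Λ^ℕ` with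
`d(x_k, ω_{σ_k}(y)) < ε` for all `k ≥ 0`. -/
theorem finite_shadowing_implies_shadowing {Λ X : Type*}
    [MetricSpace Λ] [CompactSpace Λ] [MetricSpace X] [CompactSpace X]
    (ω : Λ × X → X) (hω : Continuous ω)
    (hfin : ∀ ε > 0, ∃ δ > 0, ∀ (n : ℕ) (x : ℕ → X),
      (∀ k < n, ∃ l : Λ, dist (x (k + 1)) (ω (l, x k)) ≤ δ) →
      ∃ (y : X) (σ : ℕ → Λ), ∀ k ≤ n, dist (x k) (iterIFS ω σ k y) < ε) :
    ∀ ε > 0, ∃ δ > 0, ∀ x : ℕ → X,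
      (∀ k, ∃ l : Λ, dist (x (k + 1)) (ω (l, x k)) ≤ δ) →
      ∃ (y : X) (σ : ℕ → Λ), ∀ k, dist (x k) (iterIFS ω σ k y) < ε := by
  intro ε hε
  obtain ⟨δ, hδ, hshadow⟩ := hfin (ε / 2) (half_pos hε)
  refine ⟨δ, hδ, fun x hx => ?_⟩
  let K : ℕ → Set (X × (ℕ → Λ)) := fun n =>
    ⋂ k ≤ n, {p | dist (x k) (iterIFS ω p.2 k p.1) ≤ ε / 2}
  have hclosed : ∀ n, IsClosed (K n) := fun n =>
    isClosed_biInter fun k _ =>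
      isClosed_le (continuous_const.dist (continuous_iterIFS hω k)) continuous_const
  have hanti : ∀ n, K (n + 1) ⊆ K n := fun n =>
    Set.biInter_subset_biInter_left fun _ hk => Nat.le_succ_of_le hk
  have hne : ∀ n, (K n).Nonempty := fun n => by
    obtain ⟨y, σ, h⟩ := hshadow n x fun k _ => hx k
    exact ⟨(y, σ), Set.mem_iInter₂.2 fun k hk => (h k hk).le⟩
  obtain ⟨⟨y, σ⟩, h⟩ := IsCompact.nonempty_iInter_of_sequence_nonempty_isCompact_isClosed
    K hanti hne (hclosed 0).isCompact hclosed
  exact ⟨y, σ, fun k =>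
    (Set.mem_iInter₂.1 (Set.mem_iInter.1 h k) k le_rfl).trans_lt (half_lt_self hε)⟩
end

section
/- (Main Theorem) Every expansive IFS with the concordant shadowing property is topologically stable: if ω : Λ × X → X is an IFS on a compact metric space X which is η-expansive for some η > 0 and has the concordant shadowing property, then for every ε > 0 there exists δ > 0 such that for every IFS ω̃ with d_H({ω_λ},{ω̃_μ}) ≤ δ and every δ-compatible pair (σ, σ̃) of parameter sequences there exists a continuous map h : X → X with d_{C⁰}(ω_{σ_k} ∘ h, ω̃_{σ̃_k}) < ε for all k ∈ ℕ and d_{C⁰}(h, id) < ε. -/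
open scoped Manifold

/-- The iterate `ω_{σ_k} = ω_{λ_k} ∘ ⋯ ∘ ω_{λ_1}` of an IFS along the parameter sequence
`σ` (0-based: `σ k` is the parameter `λ_{k+1}`), as a continuous self-map;
`iterC ω σ 0 = id`. -/
def iterC {Λ X : Type*} [TopologicalSpace Λ] [TopologicalSpace X]
    (ω : C(Λ × X, X)) (σ : ℕ → Λ) : ℕ → C(X, X)
  | 0 => ContinuousMap.id X
  | k + 1 => (ω.curry (σ k)).comp (iterC ω σ k)

/-- An IFS `ω : Λ × X → X` is topologically stable if for every `ε > 0` there is `δ > 0` such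
that for every IFS `ω' : Λ' × X → X` with `d_H({ω_λ}, {ω'_μ}) ≤ δ` and every `δ`-compatible
pair of parameter sequences `(σ, σ')` (i.e. `d_{C⁰}(ω_{σ_k}, ω'_{σ'_k}) < δ` for all `k`)
there is a continuous `h : X → X` with `d_{C⁰}(ω_{σ_k} ∘ h, ω'_{σ'_k}) < ε` for all `k` and
`d_{C⁰}(h, id) < ε`. -/
def TopologicallyStable {Λ : Type u} {X : Type v} [MetricSpace Λ] [CompactSpace Λ]
    [MetricSpace X] [CompactSpace X] (ω : C(Λ × X, X)) : Prop :=
  ∀ ε > 0, ∃ δ > 0, ∀ (Λ' : Type u) [MetricSpace Λ'] [CompactSpace Λ']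
    (ω' : C(Λ' × X, X)),
    Metric.hausdorffDist (Set.range ⇑ω.curry) (Set.range ⇑ω'.curry) ≤ δ →
    ∀ (σ : ℕ → Λ) (σ' : ℕ → Λ'),
      (∀ k, dist (ω.curry (σ k)) (ω'.curry (σ' k)) < δ) →
      ∃ h : C(X, X), (∀ k, dist ((iterC ω σ k).comp h) (iterC ω' σ' k) < ε) ∧
        dist h (ContinuousMap.id X) < ε

/-- A map into a compact space whose graph is closed is continuous. -/
theorem continuous_of_isClosed_graph_of_compactSpace {X Y : Type*} [TopologicalSpace X]
    [TopologicalSpace Y] [CompactSpace Y] {f : X → Y}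
    (hf : IsClosed {p : X × Y | f p.1 = p.2}) : Continuous f := by
  refine continuous_iff_isClosed.2 fun s hs => ?_
  have hpre : f ⁻¹' s = Prod.fst '' ({p : X × Y | f p.1 = p.2} ∩ Prod.snd ⁻¹' s) := by
    ext x
    simp
  rw [hpre]
  exact isClosedMap_fst_of_compactSpace _ (hf.inter (hs.preimage continuous_snd))

/-- **Main Theorem.** Every expansive IFS with the concordant shadowing
property is topologically stable: if `ω : Λ × X → X` is `η`-expansive for some `η > 0` and
every `δ`-chain can be shadowed by a chain with the same parameter sequence, then for every
`ε > 0` there is `δ > 0` such that for every IFS `ω'` with `d_H({ω_λ}, {ω'_μ}) ≤ δ` and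
every `δ`-compatible pair `(σ, σ')` there is a continuous `h : X → X` with
`d_{C⁰}(ω_{σ_k} ∘ h, ω'_{σ'_k}) < ε` for all `k ∈ ℕ` and `d_{C⁰}(h, id) < ε`. -/
theorem expansive_concordant_implies_topStable {Λ : Type u} {X : Type v}
    [MetricSpace Λ] [CompactSpace Λ] [MetricSpace X] [CompactSpace X]
    (ω : C(Λ × X, X))
    (hexpansive : ∃ η > (0 : ℝ), ∀ (σ : ℕ → Λ) (x y : X),
      (∀ n : ℕ, dist (iterC ω σ n x) (iterC ω σ n y) ≤ η) → x = y)
    (hshadow : ∀ ε > 0, ∃ δ > 0, ∀ (σ : ℕ → Λ) (x : ℕ → X),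
      (∀ k, dist (x (k + 1)) (ω.curry (σ k) (x k)) ≤ δ) →
      ∃ y : X, ∀ k, dist (x k) (iterC ω σ k y) < ε) :
    TopologicallyStable ω := by
  intro ε hε
  obtain ⟨η, hη, hexp⟩ := hexpansive
  set r := min (ε / 2) (η / 2)
  have hrε : r ≤ ε / 2 := min_le_left _ _
  have hrη : r ≤ η / 2 := min_le_right _ _
  obtain ⟨δ, hδ, hsh⟩ := hshadow r (lt_min (half_pos hε) (half_pos hη))
  refine ⟨δ, hδ, fun Λ' _ _ ω' _ σ σ' hσ => ?_⟩
  have hex (x : X) : ∃ y, ∀ k, dist (iterC ω' σ' k x) (iterC ω σ k y) < r := by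
    refine hsh σ (fun k => iterC ω' σ' k x) fun k => ?_
    rw [dist_comm]
    exact (ContinuousMap.dist_apply_le_dist (iterC ω' σ' k x)).trans (hσ k).le
  choose h hh using hex
  have hcont : Continuous h := by
    have hG : IsClosed {p : X × X | ∀ k, dist (iterC ω' σ' k p.1) (iterC ω σ k p.2) ≤ r} := by
      simp only [Set.ofPred_forall]
      exact isClosed_iInter fun k => isClosed_le (by fun_prop) continuous_const
    refine continuous_of_isClosed_graph_of_compactSpace ?_
    convert hG using 1
    ext ⟨x, y⟩
    refine ⟨fun hxy k => ?_, fun hxy => hexp σ (h x) y fun n => ?_⟩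
    · obtain rfl : h x = y := hxy
      exact (hh x k).le
    · have h₁ := hh x n
      have h₂ := hxy n
      have h₃ := dist_triangle_left (iterC ω σ n (h x)) (iterC ω σ n y) (iterC ω' σ' n x)
      dsimp only at h₂
      linarith
  have hclose (k : ℕ) : dist ((iterC ω σ k).comp ⟨h, hcont⟩) (iterC ω' σ' k) < ε := by
    refine lt_of_le_of_lt ((ContinuousMap.dist_le (half_pos hε).le).2 fun x => ?_) (half_lt_self hε)
    rw [dist_comm]
    exact (hh x k).le.trans hrε
  exact ⟨⟨h, hcont⟩, hclose, hclose 0⟩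
end

section
/- Let f : T² → T² be the hyperbolic toral automorphism induced by (x₁,x₂) ↦ (2x₁+x₂, x₁+x₂), let Λ ⊂ ℝ² be a closed ball centered at 0, and consider the IFS ω : Λ × T² → T², ω(λ,x) = f(x) + λ (mod 1). If the single map f has the (forward) shadowing property — i.e. for every ε > 0 there is δ > 0 such that every sequence (x_k)_{k≥0} with d(x_{k+1}, f(x_k)) < δ for all k admits z with d(x_k, f^k(z)) < ε for all k — then the IFS ω has the concordant shadowing property: for every ε > 0 there is δ > 0 such that every δ-chain (y_k)_{k≥0} with parameter sequence σ ∈ Λ^ℕ admits z ∈ T² with d(y_k, ω_{σ_k}(z)) < ε for all k ≥ 0. -/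
/-- The torus `T² = ℝ²/ℤ²`. -/
abbrev T2 : Type := AddCircle (1 : ℝ) × AddCircle (1 : ℝ)

/-- The hyperbolic toral automorphism induced by `(x₁, x₂) ↦ (2x₁ + x₂, x₁ + x₂)`. -/
noncomputable def catMap : T2 → T2 := fun p => (2 • p.1 + p.2, p.1 + p.2)

/-- The projection `ℝ² → T²`. -/
noncomputable def projT2 : ℝ × ℝ → T2 := fun p => (↑p.1, ↑p.2)

theorem catMap_add (p q : T2) : catMap (p + q) = catMap p + catMap q := by
  simp only [catMap, Prod.fst_add, Prod.snd_add, Prod.mk_add_mk, smul_add]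
  congr 1 <;> abel

theorem catMap_sub (p q : T2) : catMap (p - q) = catMap p - catMap q := by
  rw [eq_sub_iff_add_eq, ← catMap_add, sub_add_cancel]

theorem iterIFS_eq_iterate_catMap_add {Λ : Type*} {ω : Λ × T2 → T2} {τ : Λ → T2}
    (hω : ∀ l x, ω (l, x) = catMap x + τ l) (σ : ℕ → Λ) (k : ℕ) (z : T2) :
    iterIFS ω σ k z = catMap^[k] z + iterIFS ω σ k 0 := by
  induction k with
  | zero => simp [iterIFS]
  | succ k ih =>
    simp only [iterIFS, hω]
    rw [ih, catMap_add, Function.iterate_succ_apply', add_assoc]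

/-- Let `f` be the toral automorphism induced by
`(x₁,x₂) ↦ (2x₁+x₂, x₁+x₂)`, let `Λ ⊂ ℝ²` be a closed ball centered at `0`, and consider the
IFS `ω(λ, x) = f(x) + λ (mod 1)` on `T²`. If the single map `f` has the (forward) shadowing
property, then the IFS `ω` has the concordant shadowing property: for every `ε > 0` there is
`δ > 0` such that every `δ`-chain `(y_k)` with parameter sequence `σ` admits `z ∈ T²` with
`d(y_k, ω_{σ_k}(z)) < ε` for all `k ≥ 0`. -/
theorem catIFS_concordant_shadowing (r : ℝ) (hr : 0 ≤ r)
    (ω : {v : ℝ × ℝ // v ∈ Metric.closedBall (0 : ℝ × ℝ) r} × T2 → T2)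
    (hω : ∀ p, ω p = catMap p.2 + projT2 (p.1 : ℝ × ℝ))
    (hshadow : ∀ ε > 0, ∃ δ > 0, ∀ x : ℕ → T2,
      (∀ k, dist (x (k + 1)) (catMap (x k)) < δ) →
      ∃ z : T2, ∀ k, dist (x k) (catMap^[k] z) < ε) :
    ∀ ε > 0, ∃ δ > 0,
      ∀ (σ : ℕ → {v : ℝ × ℝ // v ∈ Metric.closedBall (0 : ℝ × ℝ) r}) (y : ℕ → T2),
        (∀ k, dist (y (k + 1)) (ω (σ k, y k)) ≤ δ) →
        ∃ z : T2, ∀ k, dist (y k) (iterIFS ω σ k z) < ε := by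
  intro ε hε
  obtain ⟨δ, hδ, h⟩ := hshadow ε hε
  refine ⟨δ / 2, half_pos hδ, fun σ y hy => ?_⟩
  obtain ⟨z, hz⟩ := h (fun k => y k - iterIFS ω σ k 0) fun k => by
    refine lt_of_eq_of_lt ?_ ((hy k).trans_lt (half_lt_self hδ))
    simp only [iterIFS, hω, catMap_sub]
    rw [dist_eq_norm, dist_eq_norm]
    congr 1
    abel
  refine ⟨z, fun k => lt_of_eq_of_lt ?_ (hz k)⟩
  rw [iterIFS_eq_iterate_catMap_add (τ := fun l => projT2 l.1) (fun l x => hω (l, x)),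
    dist_eq_norm, dist_eq_norm]
  congr 1
  abel
end
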